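/- arXiv:2405.01341 — 3 statements merged into one kernel-verified Lean document; each statement's English description precedes it below -/
import Mathlib

section
/- Let n ≥ 1, let D be an n×n real matrix with nonnegative entries such that every row of D sums to at most 1, let F be the n×n diagonal matrix with diagonal entries f_1, …, f_n ∈ [0,1), and let θ ∈ ℝⁿ with every coordinate in [0,1]. Then the linear equation (I − F·D)·x = (I − F)·θ has a unique solution x ∈ ℝⁿ, and every coordinate of this solution lies in [0,1]. -/
open Matrix

theorem one_sub_diagonal_mul_mulVec_apply {ι : Type*} [Fintype ι] [DecidableEq ι]
    (D : Matrix ι ι ℝ) (f x : ι → ℝ) (i : ι) :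
    (((1 : Matrix ι ι ℝ) - diagonal f * D) *ᵥ x) i = x i - f i * ∑ j, D i j * x j := by
  rw [sub_mulVec, one_mulVec, ← mulVec_mulVec, Pi.sub_apply, mulVec_diagonal]
  rfl

/-- Minimum principle: `1 - diagonal f * D` is inverse-nonnegative when `D` is substochastic and
`f` takes values in `[0, 1)`. -/
theorem nonneg_of_one_sub_diagonal_mul_mulVec_nonneg {ι : Type*} [Fintype ι] [DecidableEq ι]
    {D : Matrix ι ι ℝ} (hD : ∀ i j, 0 ≤ D i j) (hrow : ∀ i, ∑ j, D i j ≤ 1)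
    {f : ι → ℝ} (hf : ∀ i, f i ∈ Set.Ico (0 : ℝ) 1) {x : ι → ℝ}
    (hx : ∀ i, 0 ≤ (((1 : Matrix ι ι ℝ) - diagonal f * D) *ᵥ x) i) (i : ι) : 0 ≤ x i := by
  have : Nonempty ι := ⟨i⟩
  obtain ⟨k, hk⟩ := Finite.exists_min x
  refine le_trans ?_ (hk i)
  by_contra! hneg
  have hle : x k ≤ ∑ j, D k j * x j := calc
    x k ≤ (∑ j, D k j) * x k := by nlinarith [hrow k]
    _ = ∑ j, D k j * x k := Finset.sum_mul ..
    _ ≤ ∑ j, D k j * x j :=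
      Finset.sum_le_sum fun j _ => mul_le_mul_of_nonneg_left (hk j) (hD k j)
  have hxk := hx k
  rw [one_sub_diagonal_mul_mulVec_apply] at hxk
  nlinarith [mul_le_mul_of_nonneg_left hle (hf k).1, (hf k).2]

theorem isUnit_one_sub_diagonal_mul {ι : Type*} [Fintype ι] [DecidableEq ι]
    {D : Matrix ι ι ℝ} (hD : ∀ i j, 0 ≤ D i j) (hrow : ∀ i, ∑ j, D i j ≤ 1)
    {f : ι → ℝ} (hf : ∀ i, f i ∈ Set.Ico (0 : ℝ) 1) :
    IsUnit ((1 : Matrix ι ι ℝ) - diagonal f * D) := by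
  rw [← mulVec_injective_iff_isUnit]
  intro x y hxy
  have hxy : ((1 : Matrix ι ι ℝ) - diagonal f * D) *ᵥ x = (1 - diagonal f * D) *ᵥ y := hxy
  have hle := nonneg_of_one_sub_diagonal_mul_mulVec_nonneg hD hrow hf (x := y - x)
    (by simp [mulVec_sub, hxy])
  have hge := nonneg_of_one_sub_diagonal_mul_mulVec_nonneg hD hrow hf (x := x - y)
    (by simp [mulVec_sub, hxy])
  funext i
  exact le_antisymm (sub_nonneg.mp (hle i)) (sub_nonneg.mp (hge i))

/-- If `D` is an `n × n` nonnegative real matrix whose rows sum to at most `1`,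
`F` is the diagonal matrix with diagonal entries `f i ∈ [0,1)`, and `θ` has all
coordinates in `[0,1]`, then `(I - F·D)·x = (I - F)·θ` has a unique solution,
and every coordinate of this solution lies in `[0,1]`. -/
theorem stmt1 (n : ℕ) (hn : 1 ≤ n) (D : Matrix (Fin n) (Fin n) ℝ)
    (hDnonneg : ∀ i j, 0 ≤ D i j) (hDrow : ∀ i, ∑ j, D i j ≤ 1)
    (f : Fin n → ℝ) (hf : ∀ i, f i ∈ Set.Ico (0 : ℝ) 1)
    (θ : Fin n → ℝ) (hθ : ∀ i, θ i ∈ Set.Icc (0 : ℝ) 1) :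
    (∃! x : Fin n → ℝ,
        ((1 : Matrix (Fin n) (Fin n) ℝ) - Matrix.diagonal f * D) *ᵥ x
          = ((1 : Matrix (Fin n) (Fin n) ℝ) - Matrix.diagonal f) *ᵥ θ) ∧
    (∀ x : Fin n → ℝ,
        ((1 : Matrix (Fin n) (Fin n) ℝ) - Matrix.diagonal f * D) *ᵥ x
          = ((1 : Matrix (Fin n) (Fin n) ℝ) - Matrix.diagonal f) *ᵥ θ →
        ∀ i, x i ∈ Set.Icc (0 : ℝ) 1) := by
  have hrhs : ∀ i, (((1 : Matrix (Fin n) (Fin n) ℝ) - diagonal f) *ᵥ θ) i = (1 - f i) * θ i := by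
    intro i
    rw [sub_mulVec, one_mulVec, Pi.sub_apply, mulVec_diagonal]
    ring
  have hunit := isUnit_one_sub_diagonal_mul hDnonneg hDrow hf
  refine ⟨Function.Bijective.existsUnique
    ⟨mulVec_injective_iff_isUnit.mpr hunit, mulVec_surjective_iff_isUnit.mpr hunit⟩ _,
    fun x hx i => ⟨?_, sub_nonneg.mp ?_⟩⟩
  · refine nonneg_of_one_sub_diagonal_mul_mulVec_nonneg hDnonneg hDrow hf (fun k => ?_) i
    rw [hx, hrhs]
    exact mul_nonneg (sub_nonneg.mpr (hf k).2.le) (hθ k).1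
  · refine nonneg_of_one_sub_diagonal_mul_mulVec_nonneg hDnonneg hDrow hf
      (x := fun j => 1 - x j) (fun k => ?_) i
    have hxk := congrFun hx k
    rw [hrhs, one_sub_diagonal_mul_mulVec_apply] at hxk
    rw [one_sub_diagonal_mul_mulVec_apply]
    simp only [mul_sub, mul_one, Finset.sum_sub_distrib]
    nlinarith [mul_le_mul_of_nonneg_left (hDrow k) (hf k).1,
      mul_le_mul_of_nonneg_left (hθ k).2 (sub_nonneg.mpr (hf k).2.le)]
end

section
/- Let f ∈ [0,1] and let x_ℓ, x_i, x_j ∈ ℝ with x_ℓ < x_i < x_j. Set m = (x_j + x_ℓ)/2 and V = f·(1−f)·(x_j − x_i)². Then 2·(V − f·(1−f)·(m − x_i)²) − f·((x_j − m)² + (x_ℓ − m)²) ≤ V − f·(1−f)·(x_ℓ − x_i)². -/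
/-- Key inequality in the disconnection-threshold proof: at the threshold value
`V = f·(1−f)·(x_j − x_i)²`, linking to both `ℓ` and `j` (mean `m`, two
neighbors) is never strictly better than linking to `ℓ` alone. -/
theorem stmt5 (f : ℝ) (hf : f ∈ Set.Icc (0 : ℝ) 1) (xl xi xj : ℝ)
    (h1 : xl < xi) (h2 : xi < xj)
    (m : ℝ) (hm : m = (xj + xl) / 2)
    (V : ℝ) (hV : V = f * (1 - f) * (xj - xi) ^ 2) :
    2 * (V - f * (1 - f) * (m - xi) ^ 2) - f * ((xj - m) ^ 2 + (xl - m) ^ 2)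
      ≤ V - f * (1 - f) * (xl - xi) ^ 2 := by
  subst hm hV
  linarith only [sq_nonneg (f * (xj - xl))]
end

section
/- Fix real numbers V > 0 and f ∈ (0,1), and for each positive integer n define δ_n = (−f + (f·(f + 9·n²·V))^{1/2})/(3·f·n) and ϑ_n = (6 − 6f + (3f·(4 + 3·(f−2)·f) + 36·(4−3f)·n²·V)^{1/2} / f^{1/2}) / ((12 − 9f)·n). Then for every natural number z, the sequence z·δ_n + ϑ_n converges to (V/f)^{1/2}·(z + 2/(4−3f)^{1/2}) as n → ∞. -/
open Filter

/-- `√(b + c n²)` grows like `√c · n`. -/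
theorem tendsto_sqrt_add_mul_sq_div (b c : ℝ) :
    Tendsto (fun n : ℕ => Real.sqrt (b + c * (n : ℝ) ^ 2) / n) atTop (nhds (Real.sqrt c)) := by
  have h : Tendsto (fun n : ℕ => Real.sqrt (b / n * (1 / n) + c)) atTop (nhds (Real.sqrt c)) := by
    have h0 := (((tendsto_const_div_atTop_nhds_zero_nat b).mul
      (tendsto_const_div_atTop_nhds_zero_nat 1)).add_const c).sqrt
    simpa only [mul_zero, zero_add] using h0
  refine h.congr' ?_
  filter_upwards [eventually_gt_atTop 0] with n hn
  have hn' : (0 : ℝ) < n := Nat.cast_pos.2 hn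
  rw [eq_div_iff hn'.ne', ← Real.sqrt_sq hn'.le, ← Real.sqrt_mul' _ (sq_nonneg _),
    Real.sqrt_sq hn'.le]
  congr 1
  field_simp

theorem tendsto_add_sqrt_div_div (a b c d e : ℝ) :
    Tendsto (fun n : ℕ => (a + Real.sqrt (b + c * (n : ℝ) ^ 2) / d) / (e * n)) atTop
      (nhds (Real.sqrt c / d / e)) := by
  have h := ((tendsto_const_div_atTop_nhds_zero_nat a).add
    ((tendsto_sqrt_add_mul_sq_div b c).div_const d)).div_const e
  rw [zero_add] at h
  refine h.congr fun n => ?_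
  simp only [div_eq_mul_inv, mul_inv]
  ring

/-- For every natural number `z`, the sequence `z·δ_n + ϑ_n` converges to
`√(V/f)·(z + 2/√(4−3f))` as `n → ∞`, where `δ_n` and `ϑ_n` are the optimal
reaches of central and extremal nodes. -/
theorem stmt12 (V f : ℝ) (hV : 0 < V) (hf : f ∈ Set.Ioo (0 : ℝ) 1) (z : ℕ) :
    Tendsto
      (fun n : ℕ =>
        (z : ℝ) *
            ((-f + Real.sqrt (f * (f + 9 * (n : ℝ) ^ 2 * V))) / (3 * f * (n : ℝ))) +
          (6 - 6 * f +
              Real.sqrt (3 * f * (4 + 3 * (f - 2) * f) + 36 * (4 - 3 * f) * (n : ℝ) ^ 2 * V)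
                / Real.sqrt f)
            / ((12 - 9 * f) * (n : ℝ)))
      atTop
      (nhds (Real.sqrt (V / f) * ((z : ℝ) + 2 / Real.sqrt (4 - 3 * f)))) := by
  obtain ⟨hf0, hf1⟩ := hf
  have hg : 0 < 4 - 3 * f := by linarith
  have h := ((tendsto_add_sqrt_div_div (-f) (f * f) (3 ^ 2 * (f * V)) 1 (3 * f)).const_mul
    (z : ℝ)).add (tendsto_add_sqrt_div_div (6 - 6 * f) (3 * f * (4 + 3 * (f - 2) * f))
      (6 ^ 2 * ((4 - 3 * f) * V)) (Real.sqrt f) (12 - 9 * f))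
  convert h using 2
  · rw [div_one]
    congr 5 <;> ring_nf
  · have hsf := Real.sqrt_pos.2 hf0
    have hsg := Real.sqrt_pos.2 hg
    have hf2 := Real.sq_sqrt hf0.le
    have hg2 := Real.sq_sqrt hg.le
    have h3 := Real.sqrt_sq (zero_le_three (α := ℝ))
    have h6 : Real.sqrt (6 ^ 2) = 6 := Real.sqrt_sq (by norm_num)
    rw [Real.sqrt_mul (sq_nonneg 3), Real.sqrt_mul (sq_nonneg 6), h3, h6,
      Real.sqrt_mul hf0.le, Real.sqrt_mul hg.le,
      Real.sqrt_div hV.le, show 12 - 9 * f = 3 * (4 - 3 * f) by ring]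
    generalize Real.sqrt (4 - 3 * f) = s at *
    generalize Real.sqrt f = t at *
    rw [← hg2, ← hf2]
    field_simp
    ring
end
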